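/- The function τ is a metric on ℤⁿ bounded by 1: τ(u,v) ≤ 1 for all u,v; τ(u,v) = 0 if and only if u = v; τ(u,v) = τ(v,u); and τ(u,w) ≤ τ(u,v) + τ(v,w) for all u,v,w ∈ ℤⁿ. -/

import Mathlib

open scoped Classical

/-- The Euclidean norm of an integer vector `u ∈ ℤⁿ`. -/
noncomputable def znorm {n : ℕ} (u : Fin n → ℤ) : ℝ :=
  Real.sqrt (∑ i : Fin n, ((u i : ℝ)) ^ 2)

/-- The unit vector `u/‖u‖` of an integer vector (with the convention
`0/‖0‖ = 0`, which holds automatically since division by `0` is `0`). -/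
noncomputable def zunit {n : ℕ} (u : Fin n → ℤ) : Fin n → ℝ :=
  fun i => (u i : ℝ) / znorm u

/-- The metric `τ` on `ℤⁿ`:
`τ(u,u) = 0`; `τ(u,v) = 1` if exactly one of `u`, `v` is `0`; and for distinct
nonzero `u`, `v`,
`τ(u,v) = min(‖u/‖u‖ − v/‖v‖‖ + |ln‖v‖ − ln‖u‖|, 1)`. -/
noncomputable def tauZ {n : ℕ} (u v : Fin n → ℤ) : ℝ :=
  if u = v then 0
  else if u = 0 ∨ v = 0 then 1
  else
    min (Real.sqrt (∑ i : Fin n, (zunit u i - zunit v i) ^ 2) +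
      |Real.log (znorm v) - Real.log (znorm u)|) 1

/-- The untruncated distance between integer vectors: the distance of their unit vectors plus the
difference of the logarithms of their norms. -/
noncomputable def polarDist {n : ℕ} (u v : Fin n → ℤ) : ℝ :=
  dist (WithLp.toLp 2 (zunit u)) (WithLp.toLp 2 (zunit v)) +
    dist (Real.log (znorm v)) (Real.log (znorm u))

theorem polarDist_self {n : ℕ} (u : Fin n → ℤ) : polarDist u u = 0 := by
  simp [polarDist]

theorem polarDist_comm {n : ℕ} (u v : Fin n → ℤ) : polarDist u v = polarDist v u := by
  simp only [polarDist, dist_comm]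

theorem polarDist_nonneg {n : ℕ} (u v : Fin n → ℤ) : 0 ≤ polarDist u v := by
  unfold polarDist
  positivity

theorem polarDist_triangle {n : ℕ} (u v w : Fin n → ℤ) :
    polarDist u w ≤ polarDist u v + polarDist v w := by
  unfold polarDist
  linarith [dist_triangle (WithLp.toLp 2 (zunit u)) (WithLp.toLp 2 (zunit v))
    (WithLp.toLp 2 (zunit w)),
    dist_triangle (Real.log (znorm w)) (Real.log (znorm v)) (Real.log (znorm u))]

theorem znorm_pos {n : ℕ} {u : Fin n → ℤ} (hu : u ≠ 0) : 0 < znorm u := by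
  obtain ⟨i, hi⟩ := Function.ne_iff.mp hu
  have hi' : (u i : ℝ) ≠ 0 := Int.cast_ne_zero.mpr hi
  exact Real.sqrt_pos.mpr <| Finset.sum_pos' (fun j _ => sq_nonneg _)
    ⟨i, Finset.mem_univ i, by positivity⟩

theorem eq_of_polarDist_eq_zero {n : ℕ} {u v : Fin n → ℤ} (hu : u ≠ 0) (hv : v ≠ 0)
    (h : polarDist u v = 0) : u = v := by
  obtain ⟨hunit, hlog⟩ := (add_eq_zero_iff_of_nonneg dist_nonneg dist_nonneg).mp h
  have hnorm : znorm v = znorm u :=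
    Real.log_injOn_pos (znorm_pos hv) (znorm_pos hu) (dist_eq_zero.mp hlog)
  have hfun : zunit u = zunit v := WithLp.toLp_injective 2 (dist_eq_zero.mp hunit)
  ext i
  have hi : (u i : ℝ) / znorm u = v i / znorm v := congrFun hfun i
  rw [hnorm, div_left_inj' (znorm_pos hu).ne'] at hi
  exact_mod_cast hi

theorem tauZ_self {n : ℕ} (u : Fin n → ℤ) : tauZ u u = 0 := if_pos rfl

theorem tauZ_eq_one {n : ℕ} {u v : Fin n → ℤ} (huv : u ≠ v) (h : u = 0 ∨ v = 0) :
    tauZ u v = 1 := by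
  rw [tauZ, if_neg huv, if_pos h]

theorem tauZ_eq_min {n : ℕ} {u v : Fin n → ℤ} (hu : u ≠ 0) (hv : v ≠ 0) :
    tauZ u v = min (polarDist u v) 1 := by
  by_cases huv : u = v
  · simp [huv, tauZ_self, polarDist_self]
  · simp [tauZ, huv, hu, hv, polarDist, EuclideanSpace.dist_eq, Real.dist_eq, sq_abs]

theorem tauZ_le_one {n : ℕ} (u v : Fin n → ℤ) : tauZ u v ≤ 1 := by
  unfold tauZ
  split_ifs
  · exact zero_le_one
  · exact le_rfl
  · exact min_le_right _ _

theorem tauZ_nonneg {n : ℕ} (u v : Fin n → ℤ) : 0 ≤ tauZ u v := by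
  unfold tauZ
  split_ifs <;> positivity

theorem tauZ_eq_zero_iff {n : ℕ} (u v : Fin n → ℤ) : tauZ u v = 0 ↔ u = v := by
  refine ⟨fun h => ?_, fun h => h ▸ tauZ_self u⟩
  by_contra huv
  by_cases h0 : u = 0 ∨ v = 0
  · exact one_ne_zero ((tauZ_eq_one huv h0).symm.trans h)
  · obtain ⟨hu, hv⟩ := not_or.mp h0
    rw [tauZ_eq_min hu hv] at h
    refine huv (eq_of_polarDist_eq_zero hu hv ?_)
    rcases min_choice (polarDist u v) 1 with h' | h' <;> linarith

theorem tauZ_comm {n : ℕ} (u v : Fin n → ℤ) : tauZ u v = tauZ v u := by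
  by_cases huv : u = v
  · rw [huv]
  by_cases h0 : u = 0 ∨ v = 0
  · rw [tauZ_eq_one huv h0, tauZ_eq_one (Ne.symm huv) h0.symm]
  · obtain ⟨hu, hv⟩ := not_or.mp h0
    rw [tauZ_eq_min hu hv, tauZ_eq_min hv hu, polarDist_comm]

theorem tauZ_triangle {n : ℕ} (u v w : Fin n → ℤ) : tauZ u w ≤ tauZ u v + tauZ v w := by
  by_cases huv : u = v
  · simp [huv, tauZ_self]
  by_cases hvw : v = w
  · simp [hvw, tauZ_self]
  by_cases huv0 : u = 0 ∨ v = 0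
  · linarith [tauZ_eq_one huv huv0, tauZ_le_one u w, tauZ_nonneg v w]
  by_cases hvw0 : v = 0 ∨ w = 0
  · linarith [tauZ_eq_one hvw hvw0, tauZ_le_one u w, tauZ_nonneg u v]
  obtain ⟨hu, hv⟩ := not_or.mp huv0
  have hw := (not_or.mp hvw0).2
  rw [tauZ_eq_min hu hw, tauZ_eq_min hu hv, tauZ_eq_min hv hw]
  have htri := polarDist_triangle u v w
  have huv_nonneg := polarDist_nonneg u v
  have hvw_nonneg := polarDist_nonneg v w
  rcases min_cases (polarDist u v) 1 with h₁ | h₁ <;>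
    rcases min_cases (polarDist v w) 1 with h₂ | h₂ <;>
    rcases min_cases (polarDist u w) 1 with h₃ | h₃ <;> linarith

/-- `τ` is a metric on `ℤⁿ` bounded by `1`. -/
theorem tauZ_is_metric_bounded_by_one {n : ℕ} (hn : 1 ≤ n) :
    (∀ u v : Fin n → ℤ, tauZ u v ≤ 1) ∧
    (∀ u v : Fin n → ℤ, tauZ u v = 0 ↔ u = v) ∧
    (∀ u v : Fin n → ℤ, tauZ u v = tauZ v u) ∧
    (∀ u v w : Fin n → ℤ, tauZ u w ≤ tauZ u v + tauZ v w) := by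
  exact ⟨tauZ_le_one, tauZ_eq_zero_iff, tauZ_comm, tauZ_triangle⟩
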